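/- There is no (a,b,c,d,e) ∈ ℂ⁵ satisfying simultaneously: a, c, d are real; e = conj(b); c = d = e+1; and both N(e) and N(12) are unitary. (That is, on the function algebra of S₃ with the Euclidean metric, no connection is at once metric preserving, torsion free and star compatible.) -/

import Mathlib

open Complex

noncomputable section

/-- The matrix `N(e) = [[a,b,b],[b,a,b],[b,b,a]]`. -/
def Nid (a b : ℂ) : Matrix (Fin 3) (Fin 3) ℂ := !![a, b, b; b, a, b; b, b, a]

/-- The matrix `N(12) = [[d,e,c],[c,d,e],[e,c,d]]`. -/
def Ntr (c d e : ℂ) : Matrix (Fin 3) (Fin 3) ℂ := !![d, e, c; c, d, e; e, c, d]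

/-- Unitarity of `N(e)` for real `a, b`: the squared norm of a row and the product of two rows. -/
theorem Nid_unitary_real {a b : ℂ} (ha : (starRingEnd ℂ) a = a) (hb : (starRingEnd ℂ) b = b)
    (h : Nid a b ∈ Matrix.unitaryGroup (Fin 3) ℂ) :
    a * a + b * b + b * b = 1 ∧ a * b + b * a + b * b = 0 := by
  rw [Matrix.mem_unitaryGroup_iff] at h
  have h₀ := congrFun (congrFun h 0) 0
  have h₁ := congrFun (congrFun h 0) 1
  simp [Nid, Matrix.mul_apply, Fin.sum_univ_three, Matrix.star_apply, ha, hb] at h₀ h₁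
  exact ⟨h₀, h₁⟩

/-- Unitarity of `N(12)` for real `c, d, e`: the product of the first two rows. -/
theorem Ntr_unitary_real {c d e : ℂ} (hc : (starRingEnd ℂ) c = c) (hd : (starRingEnd ℂ) d = d)
    (he : (starRingEnd ℂ) e = e) (h : Ntr c d e ∈ Matrix.unitaryGroup (Fin 3) ℂ) :
    d * c + e * d + c * e = 0 := by
  rw [Matrix.mem_unitaryGroup_iff] at h
  have h₁ := congrFun (congrFun h 0) 1
  simpa [Ntr, Matrix.mul_apply, Fin.sum_univ_three, Matrix.star_apply, hc, hd, he] using h₁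

/-- On the function algebra of `S₃` with the Euclidean metric, no connection is at once
metric preserving (`a, c, d` real, `e = conj b`), torsion free (`c = d = e+1`) and
star compatible (`N(e)` and `N(12)` unitary). -/
theorem no_metric_torsionFree_starCompatible :
    ¬ ∃ a b c d e : ℂ,
        (starRingEnd ℂ) a = a ∧ (starRingEnd ℂ) c = c ∧ (starRingEnd ℂ) d = d ∧
        e = (starRingEnd ℂ) b ∧
        c = e + 1 ∧ d = e + 1 ∧
        Nid a b ∈ Matrix.unitaryGroup (Fin 3) ℂ ∧
        Ntr c d e ∈ Matrix.unitaryGroup (Fin 3) ℂ := by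
  rintro ⟨a, b, c, d, e, ha, hc, hd, heb, hce, hde, hN, hM⟩
  have he : (starRingEnd ℂ) e = e := by
    rw [hce, map_add, map_one] at hc
    exact add_right_cancel hc
  obtain rfl : e = b := by rw [← he, heb, Complex.conj_conj]
  obtain ⟨h₀, h₁⟩ := Nid_unitary_real ha he hN
  have h₂ := Ntr_unitary_real hc hd he hM
  subst hce hde
  have h₃ : (e + 1) * (3 * e + 1) = 0 := by linear_combination h₂
  have h₄ : e * (2 * a + e) = 0 := by linear_combination h₁
  rcases mul_eq_zero.mp h₃ with h | h
  · obtain rfl : e = -1 := by linear_combination h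
    obtain rfl : a = 1 / 2 := by linear_combination (-1 / 2) * h₄
    norm_num at h₀
  · obtain rfl : e = -1 / 3 := by linear_combination h / 3
    obtain rfl : a = 1 / 6 := by linear_combination (-3 / 2) * h₄
    norm_num at h₀

end
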